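/- arXiv:2311.09597 — 2 statements merged into one kernel-verified Lean document; each statement's English description precedes it below -/
import Mathlib

section
/- (Matrix representation of the holonomy operator.) Let φ_1, …, φ_ℓ : ℝ → E be continuously differentiable curves that are orthonormal at every time t (⟪φ_i(t), φ_j(t)⟫ = δ_ij), and set P(t) = Σ_{i=1}^ℓ |φ_i(t)⟩⟨φ_i(t)| and A(t) the ℓ×ℓ matrix with entries A_ij(t) = ⟪φ_i'(t), φ_j(t)⟫. Suppose Γ : ℝ → Matrix (Fin ℓ) (Fin ℓ) ℂ is differentiable with Γ'(t) = A(t) * Γ(t) and Γ(0) = 1, and suppose Γ̂ : ℝ → (E →L[ℂ] E) is differentiable with Γ̂'(t) = P'(t) ∘ Γ̂(t) and Γ̂(0) = P(0). Then Γ̂(t) = Σ_{i,j=1}^ℓ Γ_ij(t) • |φ_i(t)⟩⟨φ_j(0)| for every t. -/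
open Matrix ContinuousLinearMap
open scoped ComplexConjugate

local notation "⟪" x ", " y "⟫" => @inner ℂ _ _ x y

/-- The rank-one operator `|x⟩⟨y|` sending `z` to `⟪y, z⟫ • x`. -/
noncomputable def ketbra {E : Type*} [NormedAddCommGroup E] [InnerProductSpace ℂ E]
    (x y : E) : E →L[ℂ] E :=
  (innerSL ℂ y).smulRight x

theorem ketbra_app {E : Type*} [NormedAddCommGroup E] [InnerProductSpace ℂ E]
    (x y z : E) : ketbra x y z = ⟪y, z⟫ • x := rfl

theorem ketbra_bilin {E : Type*} [NormedAddCommGroup E] [InnerProductSpace ℂ E] :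
    IsBoundedBilinearMap ℝ (fun p : E × E => ketbra p.1 p.2) where
  add_left x y z := by ext w; simp [ketbra_app]
  smul_left c x y := by
    ext w
    rw [_root_.smul_apply, ketbra_app, ketbra_app]
    exact smul_comm _ _ _
  add_right x y z := by ext w; simp [ketbra_app, inner_add_left, add_smul]
  smul_right c x y := by
    ext w
    rw [_root_.smul_apply, ketbra_app, ketbra_app, inner_smul_left_eq_smul]
    exact smul_assoc _ _ _
  bound := ⟨1, one_pos, fun x y => by
    rw [ketbra, ContinuousLinearMap.norm_smulRight_apply, innerSL_apply_norm, one_mul, mul_comm]⟩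

theorem bilin_hasDerivAt {E F G : Type*} [NormedAddCommGroup E] [NormedSpace ℝ E]
    [NormedAddCommGroup F] [NormedSpace ℝ F] [NormedAddCommGroup G] [NormedSpace ℝ G]
    {b : E → F → G} (hb : IsBoundedBilinearMap ℝ (fun p : E × F => b p.1 p.2))
    {x : ℝ → E} {y : ℝ → F} {x' : E} {y' : F} {t : ℝ}
    (hx : HasDerivAt x x' t) (hy : HasDerivAt y y' t) :
    HasDerivAt (fun s => b (x s) (y s)) (b (x t) y' + b x' (y t)) t := by
  have h := hb.hasFDerivAt (x t, y t)
  exact HasFDerivAt.comp_hasDerivAt (f := fun s => (x s, y s)) t h (hx.prodMk hy)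

theorem ketbra_hasDerivAt {E : Type*} [NormedAddCommGroup E] [InnerProductSpace ℂ E]
    {x y : ℝ → E} {x' y' : E} {t : ℝ} (hx : HasDerivAt x x' t) (hy : HasDerivAt y y' t) :
    HasDerivAt (fun s => ketbra (x s) (y s)) (ketbra (x t) y' + ketbra x' (y t)) t :=
  bilin_hasDerivAt ketbra_bilin hx hy

theorem smul_ketbra_hasDerivAt {E : Type*} [NormedAddCommGroup E] [InnerProductSpace ℂ E]
    {c : ℝ → ℂ} {c' : ℂ} {x : ℝ → E} {x' : E} {t : ℝ} (hc : HasDerivAt c c' t)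
    (hx : HasDerivAt x x' t) (y : E) :
    HasDerivAt (fun s => c s • ketbra (x s) y)
      (c t • ketbra x' y + c' • ketbra (x t) y) t := by
  have h := ketbra_hasDerivAt (hc.smul hx) (hasDerivAt_const t y)
  have e : ∀ (a : ℂ) (v : E), a • ketbra v y = ketbra (a • v) y := by
    intro a v
    ext z
    simp only [_root_.smul_apply, ketbra_app]
    exact smul_comm _ _ _
  have e2 : ∀ v w : E, ketbra v y + ketbra w y = ketbra (v + w) y := by
    intro v w
    ext z
    simp [ketbra_app]
  have e3 : ∀ v : E, ketbra v (0 : E) = 0 := by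
    intro v
    ext z
    simp [ketbra_app]
  simp only [e, e2]
  rw [e3, zero_add] at h
  exact h

/-- Matrix representation of the holonomy operator:
`Γ̂(t) = Σ_{i,j} Γ_ij(t) • |φ_i(t)⟩⟨φ_j(0)|`. -/
theorem holonomy_operator_matrix_representation
    {E : Type*} [NormedAddCommGroup E] [InnerProductSpace ℂ E] [FiniteDimensional ℂ E]
    (ℓ : ℕ) (hℓ : 0 < ℓ)
    (φ : Fin ℓ → ℝ → E)
    (hφsmooth : ∀ i, ContDiff ℝ 1 (φ i))
    (hφON : ∀ i j t, ⟪φ i t, φ j t⟫ = if i = j then (1 : ℂ) else 0)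
    (P : ℝ → E →L[ℂ] E) (hP : ∀ t, P t = ∑ i, ketbra (φ i t) (φ i t))
    (A : ℝ → Matrix (Fin ℓ) (Fin ℓ) ℂ)
    (hA : ∀ t i j, A t i j = ⟪deriv (φ i) t, φ j t⟫)
    (Γ : ℝ → Matrix (Fin ℓ) (Fin ℓ) ℂ)
    (hΓODE : ∀ t i j, HasDerivAt (fun s => Γ s i j) ((A t * Γ t) i j) t)
    (hΓ0 : Γ 0 = 1)
    (Γhat : ℝ → E →L[ℂ] E)
    (hΓhatODE : ∀ t, HasDerivAt Γhat (deriv P t ∘L Γhat t) t)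
    (hΓhat0 : Γhat 0 = P 0) :
    ∀ t, Γhat t = ∑ i, ∑ j, Γ t i j • ketbra (φ i t) (φ j 0) := by
  have hB := ketbra_bilin (E := E)
  have hφd : ∀ i t, HasDerivAt (φ i) (deriv (φ i) t) t := fun i t =>
    ((hφsmooth i).differentiable (by norm_num) t).hasDerivAt
  have hφc : ∀ i, Continuous (deriv (φ i)) := fun i => (hφsmooth i).continuous_deriv le_rfl
  have hPd : ∀ t, deriv P t
      = ∑ i, (ketbra (φ i t) (deriv (φ i) t) + ketbra (deriv (φ i) t) (φ i t)) := by
    intro t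
    have : P = fun t => ∑ i, ketbra (φ i t) (φ i t) := funext hP
    rw [this]
    exact (HasDerivAt.fun_sum fun i _ => ketbra_hasDerivAt (hφd i t) (hφd i t)).deriv
  have hPc : Continuous (deriv P) := by
    rw [funext hPd]
    refine continuous_finsetSum _ fun i _ => ?_
    exact (hB.continuous.comp ((hφsmooth i).continuous.prodMk (hφc i))).add
      (hB.continuous.comp ((hφc i).prodMk (hφsmooth i).continuous))
  have hG : ∀ t, HasDerivAt (fun t => ∑ i, ∑ j, Γ t i j • ketbra (φ i t) (φ j 0))
      (deriv P t ∘L (∑ i, ∑ j, Γ t i j • ketbra (φ i t) (φ j 0))) t := by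
    intro t
    have h1 := HasDerivAt.fun_sum (u := Finset.univ) fun i _ =>
      HasDerivAt.fun_sum (u := Finset.univ) fun j _ =>
      smul_ketbra_hasDerivAt (hΓODE t i j) (hφd i t) (φ j 0)
    refine h1.congr_deriv ?_
    rw [hPd]
    ext z
    simp only [ContinuousLinearMap.sum_apply, ContinuousLinearMap.add_apply,
      _root_.smul_apply, ContinuousLinearMap.comp_apply, ketbra_app, inner_sum,
      inner_smul_right, hφON, inner_zero_left, zero_smul, zero_add, Matrix.mul_apply, hA]
    simp only [Finset.sum_add_distrib, Finset.sum_smul, mul_ite, mul_one, mul_zero, smul_smul,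
      Finset.sum_mul, ite_mul, zero_mul]
    rw [add_comm]
    congr 1
    · refine Finset.sum_congr rfl fun i _ => ?_
      rw [Finset.sum_comm]
      refine Finset.sum_congr rfl fun k _ => Finset.sum_congr rfl fun j _ => ?_
      congr 1; ring
    · refine Finset.sum_congr rfl fun i _ => ?_
      rw [Finset.sum_comm]
      simp
  intro t
  have hcpt : IsCompact (Set.Icc (-(|t| + 1)) (|t| + 1)) := isCompact_Icc
  obtain ⟨C, hC⟩ := hcpt.exists_bound_of_continuousOn hPc.continuousOn
  have ht := abs_le.1 (le_refl |t|)
  have h0 := abs_nonneg t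
  refine ODE_solution_unique_of_mem_Ioo (a := -(|t| + 1)) (b := |t| + 1) (t₀ := 0)
    (v := fun t X => deriv P t ∘L X) (K := C.toNNReal) (s := fun _ => Set.univ) (f := Γhat)
    (g := fun t => ∑ i, ∑ j, Γ t i j • ketbra (φ i t) (φ j 0))
    ?_ ⟨by linarith, by linarith⟩ (fun t _ => ⟨hΓhatODE t, trivial⟩)
    (fun t _ => ⟨hG t, trivial⟩) ?_ ⟨by linarith, by linarith⟩
  · intro s hs
    refine (LipschitzWith.of_dist_le_mul fun X Y => ?_).lipschitzOnWith
    rw [dist_eq_norm, dist_eq_norm, ← ContinuousLinearMap.comp_sub]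
    refine (ContinuousLinearMap.opNorm_comp_le _ _).trans ?_
    gcongr
    exact (hC s ⟨hs.1.le, hs.2.le⟩).trans (Real.le_coe_toNNReal C)
  · simp [hΓhat0, hP, hΓ0, Matrix.one_apply]
end

section
/- (Gauge invariance of the holonomy matrix.) Let φ_1, …, φ_ℓ and φ̃_1, …, φ̃_ℓ : ℝ → E be two continuously differentiable families, each orthonormal at every time t, spanning the same subspace at each time: Σ_{i=1}^ℓ |φ_i(t)⟩⟨φ_i(t)| = Σ_{i=1}^ℓ |φ̃_i(t)⟩⟨φ̃_i(t)| for all t, and satisfying φ̃_i(0) = φ_i(0), φ_i(T) = φ_i(0), and φ̃_i(T) = φ̃_i(0) for all i, for some T ∈ ℝ. Let A(t) and Ã(t) be the ℓ×ℓ matrices with entries A_ij(t) = ⟪φ_i'(t), φ_j(t)⟫ and Ã_ij(t) = ⟪φ̃_i'(t), φ̃_j(t)⟫, and let Γ, Γ̃ : ℝ → Matrix (Fin ℓ) (Fin ℓ) ℂ be differentiable with Γ'(t) = A(t) * Γ(t), Γ̃'(t) = Ã(t) * Γ̃(t), and Γ(0) = Γ̃(0) = 1. Then Γ(T) = Γ̃(T).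 -/
open Matrix ContinuousLinearMap
open scoped ComplexConjugate

local notation "⟪" x ", " y "⟫" => @inner ℂ _ _ x y

theorem md_mul {n : ℕ} {X Y : ℝ → Matrix (Fin n) (Fin n) ℂ} {X' Y' : Matrix (Fin n) (Fin n) ℂ}
    {t : ℝ} (hX : ∀ i j, HasDerivAt (fun s => X s i j) (X' i j) t)
    (hY : ∀ i j, HasDerivAt (fun s => Y s i j) (Y' i j) t) (i j : Fin n) :
    HasDerivAt (fun s => (X s * Y s) i j) ((X' * Y t + X t * Y') i j) t := by
  simp only [Matrix.add_apply, Matrix.mul_apply, ← Finset.sum_add_distrib]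
  exact HasDerivAt.fun_sum fun k _ => (hX i k).mul (hY k j)

theorem md_star {n : ℕ} {X : ℝ → Matrix (Fin n) (Fin n) ℂ} {X' : Matrix (Fin n) (Fin n) ℂ}
    {t : ℝ} (hX : ∀ i j, HasDerivAt (fun s => X s i j) (X' i j) t) (i j : Fin n) :
    HasDerivAt (fun s => (X s)ᴴ i j) (X'ᴴ i j) t := by
  simp only [Matrix.conjTranspose_apply]
  exact (hX j i).star

theorem skew_ode_const {n : ℕ} {A X Y : ℝ → Matrix (Fin n) (Fin n) ℂ}
    (hA : ∀ t, (A t)ᴴ = - A t)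
    (hX : ∀ t i j, HasDerivAt (fun s => X s i j) ((A t * X t) i j) t)
    (hY : ∀ t i j, HasDerivAt (fun s => Y s i j) ((A t * Y t) i j) t)
    (hX0 : X 0 = 1) (hY0 : Y 0 = 1) (T : ℝ) : (X T)ᴴ * Y T = 1 := by
  have h0 : (X 0)ᴴ * Y 0 = 1 := by simp [hX0, hY0]
  rw [← h0]
  ext i j
  have hd : ∀ t, HasDerivAt (fun s => ((X s)ᴴ * Y s) i j) 0 t := by
    intro t
    have h := md_mul (X := fun s => (X s)ᴴ) (md_star (hX t)) (hY t) i j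
    have e : (A t * X t)ᴴ * Y t + (X t)ᴴ * (A t * Y t) = 0 := by
      rw [Matrix.conjTranspose_mul, hA]
      noncomm_ring
    rw [e] at h
    exact h
  exact is_const_of_deriv_eq_zero (fun t => (hd t).differentiableAt) (fun t => (hd t).deriv) T 0

theorem frame_skew {E : Type*} [NormedAddCommGroup E] [InnerProductSpace ℂ E]
    {n : ℕ} {φ : Fin n → ℝ → E} (hs : ∀ i, ContDiff ℝ 1 (φ i))
    (hON : ∀ i j t, ⟪φ i t, φ j t⟫ = if i = j then (1 : ℂ) else 0) (i j : Fin n) (t : ℝ) :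
    ⟪φ i t, deriv (φ j) t⟫ = - ⟪deriv (φ i) t, φ j t⟫ := by
  have hd : ∀ i, HasDerivAt (φ i) (deriv (φ i) t) t := fun i =>
    ((hs i).differentiable one_ne_zero t).hasDerivAt
  have h := (hd i).inner ℂ (hd j)
  simp only [hON] at h
  exact eq_neg_of_add_eq_zero_left (h.unique (hasDerivAt_const t _))

/-- Gauge invariance of the holonomy matrix: two bases of the same moving subspace
with the same initial condition, both closing up at time `T`, yield the same
holonomy matrix `Γ(T) = Γ̃(T)`. -/
theorem holonomy_matrix_gauge_invariance
    {E : Type*} [NormedAddCommGroup E] [InnerProductSpace ℂ E] [FiniteDimensional ℂ E]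
    (ℓ : ℕ) (hℓ : 0 < ℓ)
    (φ φt : Fin ℓ → ℝ → E)
    (hφsmooth : ∀ i, ContDiff ℝ 1 (φ i))
    (hφtsmooth : ∀ i, ContDiff ℝ 1 (φt i))
    (hφON : ∀ i j t, ⟪φ i t, φ j t⟫ = if i = j then (1 : ℂ) else 0)
    (hφtON : ∀ i j t, ⟪φt i t, φt j t⟫ = if i = j then (1 : ℂ) else 0)
    (hspan : ∀ t, ∑ i, ketbra (φ i t) (φ i t) = ∑ i, ketbra (φt i t) (φt i t))
    (hφt0 : ∀ i, φt i 0 = φ i 0)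
    (T : ℝ)
    (hcyc : ∀ i, φ i T = φ i 0)
    (hcyct : ∀ i, φt i T = φt i 0)
    (A At : ℝ → Matrix (Fin ℓ) (Fin ℓ) ℂ)
    (hA : ∀ t i j, A t i j = ⟪deriv (φ i) t, φ j t⟫)
    (hAt : ∀ t i j, At t i j = ⟪deriv (φt i) t, φt j t⟫)
    (Γ Γt : ℝ → Matrix (Fin ℓ) (Fin ℓ) ℂ)
    (hΓODE : ∀ t i j, HasDerivAt (fun s => Γ s i j) ((A t * Γ t) i j) t)
    (hΓtODE : ∀ t i j, HasDerivAt (fun s => Γt s i j) ((At t * Γt t) i j) t)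
    (hΓ0 : Γ 0 = 1) (hΓt0 : Γt 0 = 1) :
    Γ T = Γt T := by
  have hd : ∀ i t, HasDerivAt (φ i) (deriv (φ i) t) t := fun i t =>
    ((hφsmooth i).differentiable one_ne_zero t).hasDerivAt
  have hdt : ∀ i t, HasDerivAt (φt i) (deriv (φt i) t) t := fun i t =>
    ((hφtsmooth i).differentiable one_ne_zero t).hasDerivAt
  have hAs : ∀ t, (A t)ᴴ = - A t := by
    intro t
    ext i j
    rw [Matrix.conjTranspose_apply, Matrix.neg_apply, hA, hA, ← frame_skew hφsmooth hφON]
    exact inner_conj_symm _ _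
  have hsp : ∀ t z, ∑ i, ⟪φ i t, z⟫ • φ i t = ∑ i, ⟪φt i t, z⟫ • φt i t := by
    intro t z
    have h := congrArg (fun L : E →L[ℂ] E => L z) (hspan t)
    simpa [ketbra] using h
  have e1 : ∀ t j, φt j t = ∑ k, ⟪φ k t, φt j t⟫ • φ k t := by
    intro t j
    rw [hsp]
    simp [hφtON]
  have e2 : ∀ t j, φ j t = ∑ k, ⟪φt k t, φ j t⟫ • φt k t := by
    intro t j
    rw [← hsp]
    simp [hφON]
  let W : ℝ → Matrix (Fin ℓ) (Fin ℓ) ℂ := fun t => Matrix.of fun i j => ⟪φ i t, φt j t⟫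
  have hW : ∀ t i j, HasDerivAt (fun s => W s i j) ((A t * W t - W t * At t) i j) t := by
    intro t i j
    have h := (hd i t).inner ℂ (hdt j t)
    have a1 : ⟪deriv (φ i) t, φt j t⟫ = (A t * W t) i j := by
      conv_lhs => rw [e1 t j]
      rw [inner_sum, Matrix.mul_apply]
      refine Finset.sum_congr rfl fun k _ => ?_
      rw [inner_smul_right, hA, mul_comm]
      rfl
    have a2 : ⟪φ i t, deriv (φt j) t⟫ = - (W t * At t) i j := by
      conv_lhs => rw [e2 t i]
      rw [sum_inner, Matrix.mul_apply, ← Finset.sum_neg_distrib]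
      refine Finset.sum_congr rfl fun k _ => ?_
      rw [inner_smul_left, frame_skew hφtsmooth hφtON, hAt, inner_conj_symm, mul_neg]
      rfl
    rw [a1, a2] at h
    have e : (A t * W t - W t * At t) i j = -(W t * At t) i j + (A t * W t) i j := by
      rw [Matrix.sub_apply]
      ring
    rw [e]
    exact h
  have hWΓ : ∀ t i j, HasDerivAt (fun s => (W s * Γt s) i j) ((A t * (W t * Γt t)) i j) t := by
    intro t i j
    have h := md_mul (hW t) (hΓtODE t) i j
    have e : (A t * W t - W t * At t) * Γt t + W t * (At t * Γt t) = A t * (W t * Γt t) := by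
      noncomm_ring
    rwa [e] at h
  have hW0 : W 0 = 1 := by
    ext i j
    simp [W, hφt0, hφON, Matrix.one_apply]
  have hWT : W T = 1 := by
    ext i j
    simp [W, hφt0, hcyc, hcyct, hφON, Matrix.one_apply]
  have c1 := skew_ode_const hAs hΓODE hΓODE hΓ0 hΓ0 T
  have c2 := skew_ode_const hAs hΓODE hWΓ hΓ0 (by rw [hW0, hΓt0, one_mul]) T
  rw [hWT, one_mul] at c2
  have c3 : Γ T * (Γ T)ᴴ = 1 := mul_eq_one_comm.mp c1
  calc Γ T = Γ T * ((Γ T)ᴴ * Γt T) := by rw [c2, mul_one]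
    _ = Γt T := by rw [← mul_assoc, c3, one_mul]
end
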